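/- The infinite series identity $\sum_{k=0}^{\infty}\Big(\frac{-1}{4}\Big)^k\frac{((1)_k)^3(1/2)_k}{((5/4)_k)^2((7/4)_k)^2}\Big\{(19+56k+40k^2)\big[H_k^{(2)}+H_{1+2k}^{(2)}-4H_{3+4k}^{(2)}+4\big]+4\Big\} = 72G - 72\beta(4)$ holds. -/

import Mathlib

open scoped BigOperators

/-- The shifted factorial (Pochhammer symbol) `(x)_n = x (x+1) ⋯ (x+n-1)`. -/
noncomputable def poch (x : ℝ) (n : ℕ) : ℝ := ∏ i ∈ Finset.range n, (x + i)

/-- The harmonic numbers of order 2, `H_n^{(2)} = ∑_{j=1}^n 1/j²`. -/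
noncomputable def H2 (n : ℕ) : ℝ := ∑ j ∈ Finset.range n, 1 / ((j : ℝ) + 1) ^ 2

/-- The Dirichlet beta value `β(4) = ∑_{k≥0} (-1)^k/(1+2k)⁴`. -/
noncomputable def beta4 : ℝ := ∑' k : ℕ, (-1) ^ k / (1 + 2 * (k : ℝ)) ^ 4

/-- The Catalan constant `G = ∑_{k≥0} (-1)^k/(1+2k)²`. -/
noncomputable def catalanG : ℝ := ∑' k : ℕ, (-1) ^ k / (1 + 2 * (k : ℝ)) ^ 2

/-- If `F n (k + 1) - F n k = G (n + 1) k - G n k` and both `F` and `G` are dominated by a product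
of summable sequences, then `∑ G 0 k = ∑ F n 0`. -/
lemma tsum_eq_tsum_of_wz_pair {F G : ℕ → ℕ → ℝ} {u v : ℕ → ℝ} (hu : Summable u) (hv : Summable v)
    (hF : ∀ n k, |F n k| ≤ v k * u n) (hG : ∀ n k, |G n k| ≤ v k * u n)
    (hFG : ∀ n k, F n (k + 1) - F n k = G (n + 1) k - G n k) :
    ∑' k, G 0 k = ∑' n, F n 0 := by
  have hFs (k : ℕ) : Summable fun n => F n k :=
    Summable.of_norm_bounded (hu.mul_left (v k)) fun n => hF n k
  have hGs (k : ℕ) : Summable fun n => G n k :=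
    Summable.of_norm_bounded (hu.mul_left (v k)) fun n => hG n k
  have hG0 : Summable fun k => G 0 k :=
    Summable.of_norm_bounded (hv.mul_right (u 0)) fun k => hG 0 k
  have hstep (k : ℕ) : ∑' n, F n (k + 1) = ∑' n, F n k - G 0 k := by
    have h₁ : ∑' n, (F n (k + 1) - F n k) = ∑' n, (G (n + 1) k - G n k) :=
      tsum_congr fun n => hFG n k
    rw [(hFs _).tsum_sub (hFs _), ((summable_nat_add_iff 1).2 (hGs k)).tsum_sub (hGs k),
      (hGs k).tsum_eq_zero_add] at h₁
    linarith
  have hpartial (K : ℕ) : ∑ k ∈ Finset.range K, G 0 k = ∑' n, F n 0 - ∑' n, F n K := by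
    induction K with
    | zero => simp
    | succ K ih => rw [Finset.sum_range_succ, ih, hstep]; ring
  have hlim : Filter.Tendsto (fun K => ∑' n, F n K) Filter.atTop (nhds 0) := by
    have hv0 := hv.tendsto_atTop_zero.mul_const (∑' n, u n)
    rw [zero_mul] at hv0
    refine squeeze_zero_norm (fun K => ?_) hv0
    rw [← tsum_mul_left]
    exact tsum_of_norm_bounded (hu.mul_left (v K)).hasSum fun n => hF n K
  refine tendsto_nhds_unique hG0.hasSum.tendsto_sum_nat ?_
  simp_rw [hpartial]
  simpa using hlim.const_sub (∑' n, F n 0)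

lemma poch_succ (x : ℝ) (n : ℕ) : poch x (n + 1) = poch x n * (x + n) :=
  Finset.prod_range_succ _ _

lemma poch_succ_left (x : ℝ) (n : ℕ) : poch x (n + 1) = x * poch (x + 1) n := by
  simp only [poch, Finset.prod_range_succ', Nat.cast_zero, add_zero, mul_comm x]
  congr 1
  exact Finset.prod_congr rfl fun i _ => by push_cast; ring

lemma poch_pos {x : ℝ} (hx : 0 < x) (n : ℕ) : 0 < poch x n :=
  Finset.prod_pos fun i _ => by positivity

lemma poch_one (n : ℕ) : poch 1 n = n.factorial := by
  induction n with
  | zero => simp [poch]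
  | succ n ih => rw [poch_succ, ih, Nat.factorial_succ]; push_cast; ring

lemma mul_factorial_le_poch_succ {x : ℝ} (hx : 0 < x) (n : ℕ) :
    x * n.factorial ≤ poch x (n + 1) := by
  induction n with
  | zero => simp [poch]
  | succ n ih =>
    rw [poch_succ, Nat.factorial_succ]
    push_cast
    calc x * (((n : ℝ) + 1) * n.factorial) = x * n.factorial * (n + 1) := by ring
      _ ≤ poch x (n + 1) * (x + (n + 1)) := by
        have := poch_pos hx (n + 1)
        exact mul_le_mul ih (by linarith) (by positivity) this.le

lemma factorial_two_mul_eq_poch (k : ℕ) :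
    ((2 * k).factorial : ℝ) = 4 ^ k * poch 1 k * poch (1 / 2) k := by
  induction k with
  | zero => simp [poch]
  | succ k ih =>
    rw [show 2 * (k + 1) = 2 * k + 1 + 1 by ring, Nat.factorial_succ, Nat.factorial_succ]
    push_cast
    rw [ih, poch_succ, poch_succ]
    ring

lemma poch_half_two_mul_add_two (k : ℕ) :
    poch (1 / 2) (2 * k + 2) = 3 / 4 * 4 ^ k * poch (5 / 4) k * poch (7 / 4) k := by
  induction k with
  | zero => norm_num [poch, Finset.prod_range_succ]
  | succ k ih =>
    rw [show 2 * (k + 1) + 2 = 2 * k + 2 + 1 + 1 by ring, poch_succ, poch_succ, ih, poch_succ,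
      poch_succ]
    push_cast
    ring

lemma factorial_sq_div_factorial_two_mul_le (k : ℕ) :
    (k.factorial : ℝ) ^ 2 / (2 * k).factorial ≤ (1 / 2) ^ k := by
  induction k with
  | zero => simp
  | succ k ih =>
    rw [show 2 * (k + 1) = 2 * k + 1 + 1 by ring, Nat.factorial_succ, Nat.factorial_succ,
      Nat.factorial_succ, pow_succ]
    push_cast
    have h0 : (0 : ℝ) < (2 * k).factorial := by positivity
    calc (((k : ℝ) + 1) * k.factorial) ^ 2 / ((2 * k + 1 + 1) * ((2 * k + 1) * (2 * k).factorial))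
        = (k.factorial : ℝ) ^ 2 / (2 * k).factorial * ((k + 1) / (2 * (2 * k + 1))) := by
          field_simp
          ring
      _ ≤ (1 / 2) ^ k * (1 / 2) := by
          refine mul_le_mul ih ?_ (by positivity) (by positivity)
          rw [div_le_div_iff₀ (by positivity) (by positivity)]
          have : (0 : ℝ) ≤ k := k.cast_nonneg
          linarith

lemma H2_succ (n : ℕ) : H2 (n + 1) = H2 n + 1 / ((n : ℝ) + 1) ^ 2 :=
  Finset.sum_range_succ _ _

lemma H2_nonneg (n : ℕ) : 0 ≤ H2 n := Finset.sum_nonneg fun i _ => by positivity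

lemma H2_le_two (n : ℕ) : H2 n ≤ 2 := by
  have h : H2 n ≤ 2 - 2 / ((n : ℝ) + 1) := by
    induction n with
    | zero => simp [H2]
    | succ n ih =>
      have hstep : 1 / ((n : ℝ) + 1) ^ 2 ≤ 2 / ((n : ℝ) + 1) - 2 / ((n : ℝ) + 1 + 1) := by
        rw [div_sub_div _ _ (by positivity) (by positivity),
          div_le_div_iff₀ (by positivity) (by positivity)]
        have : (0 : ℝ) ≤ n := n.cast_nonneg
        nlinarith [sq_nonneg (n : ℝ), mul_nonneg this (sq_nonneg (n : ℝ))]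
      rw [H2_succ]
      push_cast
      linarith
  have : (0 : ℝ) ≤ 2 / ((n : ℝ) + 1) := by positivity
  linarith

/-- The shifted harmonic sum `∑_{i<m} 1/(x+i)²`. -/
noncomputable def shiftedH2 (x : ℝ) (m : ℕ) : ℝ := ∑ i ∈ Finset.range m, 1 / (x + i) ^ 2

lemma shiftedH2_succ (x : ℝ) (m : ℕ) :
    shiftedH2 x (m + 1) = shiftedH2 x m + 1 / (x + m) ^ 2 :=
  Finset.sum_range_succ _ _

lemma shiftedH2_succ_left (x : ℝ) (m : ℕ) :
    shiftedH2 x (m + 1) = 1 / x ^ 2 + shiftedH2 (x + 1) m := by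
  simp only [shiftedH2, Finset.sum_range_succ', Nat.cast_zero, add_zero, add_comm (1 / x ^ 2)]
  congr 1
  exact Finset.sum_congr rfl fun i _ => by push_cast; ring

lemma shiftedH2_nonneg (x : ℝ) (m : ℕ) : 0 ≤ shiftedH2 x m :=
  Finset.sum_nonneg fun i _ => by positivity

lemma shiftedH2_le_eight {x : ℝ} (hx : 1 / 2 ≤ x) (m : ℕ) : shiftedH2 x m ≤ 8 := by
  have h : shiftedH2 x m ≤ 4 * H2 m := by
    rw [shiftedH2, H2, Finset.mul_sum]
    refine Finset.sum_le_sum fun i _ => ?_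
    have hi : (0 : ℝ) ≤ i := i.cast_nonneg
    calc 1 / (x + i) ^ 2 ≤ 1 / (((i : ℝ) + 1) / 2) ^ 2 := by
          gcongr
          linarith
      _ = 4 * (1 / ((i : ℝ) + 1) ^ 2) := by
          field_simp
          norm_num
  linarith [H2_le_two m]

lemma shiftedH2_half_succ (m : ℕ) :
    shiftedH2 (1 / 2) (m + 1) = 4 * H2 (2 * m + 1) - H2 m := by
  induction m with
  | zero => norm_num [shiftedH2, H2]
  | succ m ih =>
    rw [shiftedH2_succ, ih, show 2 * (m + 1) + 1 = 2 * m + 1 + 1 + 1 by ring, H2_succ (2 * m + 1 + 1),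
      H2_succ (2 * m + 1), H2_succ m]
    push_cast
    field_simp
    ring

/-- The harmonic weight common to both members of the WZ pair. -/
noncomputable def wzWeight (x : ℝ) (k m : ℕ) : ℝ := 4 + H2 k - shiftedH2 x m

lemma abs_wzWeight_le {x : ℝ} (hx : 1 / 2 ≤ x) (k m : ℕ) : |wzWeight x k m| ≤ 6 := by
  rw [wzWeight, abs_le]
  constructor <;>
    linarith [H2_nonneg k, H2_le_two k, shiftedH2_nonneg x m, shiftedH2_le_eight hx m]

/-- The hypergeometric factor `(2k)! k!² / ((x)_m)²` of the WZ pair. -/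
noncomputable def wzFactor (x : ℝ) (k m : ℕ) : ℝ :=
  (2 * k).factorial * (k.factorial : ℝ) ^ 2 / poch x m ^ 2

/-- The quadratic polynomial in the WZ certificate, in terms of `n` and `k`. -/
noncomputable def wzPoly (n k : ℝ) : ℝ :=
  n ^ 2 / 2 + (2 + 3 * k) * n + (19 + 56 * k + 40 * k ^ 2) / 8

/-- First member of the WZ pair; at `k = 0` it is the summand of `16 G - 16 β(4)`. -/
noncomputable def wzF (n k : ℕ) : ℝ :=
  (-1) ^ (n + k) * (wzFactor (n + 1 / 2) k (2 * k + 1) * wzWeight (n + 1 / 2) k (2 * k + 1))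

/-- Second member of the WZ pair; at `n = 0` it is a multiple of the accelerated summand. -/
noncomputable def wzG (n k : ℕ) : ℝ :=
  (-1) ^ (n + k) * (wzFactor (n + 1 / 2) k (2 * k + 2) *
    (wzPoly n k * wzWeight (n + 1 / 2) k (2 * k + 2) + 1 / 2))

lemma wzF_succ_sub (n k : ℕ) : wzF n (k + 1) - wzF n k = wzG (n + 1) k - wzG n k := by
  have hx : (0 : ℝ) < n + 1 / 2 := by positivity
  have hpoch : poch ((n : ℝ) + 1 / 2 + 1) (2 * k + 2) =
      poch (n + 1 / 2) (2 * k + 1) * (n + 2 * k + 3 / 2) * (n + 2 * k + 5 / 2) / (n + 1 / 2) := by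
    rw [eq_div_iff hx.ne', mul_comm, ← poch_succ_left, poch_succ, poch_succ]
    push_cast
    ring
  have hsum : shiftedH2 ((n : ℝ) + 1 / 2 + 1) (2 * k + 2) =
      shiftedH2 (n + 1 / 2) (2 * k + 1) + 1 / (n + 2 * k + 3 / 2) ^ 2 +
        1 / (n + 2 * k + 5 / 2) ^ 2 - 1 / (n + 1 / 2) ^ 2 := by
    rw [eq_sub_iff_add_eq, add_comm, ← shiftedH2_succ_left, shiftedH2_succ, shiftedH2_succ]
    push_cast
    ring
  have hcast : ((n + 1 : ℕ) : ℝ) + 1 / 2 = n + 1 / 2 + 1 := by push_cast; ring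
  have hk : 2 * (k + 1) + 1 = 2 * k + 1 + 1 + 1 := by ring
  have hk' : 2 * (k + 1) = 2 * k + 1 + 1 := by ring
  simp only [wzF, wzG, wzFactor, wzWeight, hcast, hpoch, hsum]
  rw [hk, hk']
  simp only [poch_succ _ (2 * k + 1), poch_succ _ (2 * k + 1 + 1), shiftedH2_succ _ (2 * k + 1),
    shiftedH2_succ _ (2 * k + 1 + 1), H2_succ, Nat.factorial_succ, wzPoly]
  have hq := poch_pos hx (2 * k + 1)
  generalize poch ((n : ℝ) + 1 / 2) (2 * k + 1) = q at hq ⊢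
  generalize shiftedH2 ((n : ℝ) + 1 / 2) (2 * k + 1) = s
  generalize H2 k = h
  have e1 : (n : ℝ) + 1 / 2 + ((2 * k + 1 : ℕ) : ℝ) = n + 2 * k + 3 / 2 := by push_cast; ring
  have e2 : (n : ℝ) + 1 / 2 + ((2 * k + 1 + 1 : ℕ) : ℝ) = n + 2 * k + 5 / 2 := by
    push_cast; ring
  rw [e1, e2, show n + (k + 1) = n + k + 1 by ring, show n + 1 + k = n + k + 1 by ring, pow_succ]
  push_cast
  have h1 : (0 : ℝ) < n + 2 * k + 3 / 2 := by positivity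
  have h2 : (0 : ℝ) < n + 2 * k + 5 / 2 := by positivity
  have h3 : (0 : ℝ) < (k : ℝ) + 1 := by positivity
  field_simp
  ring

lemma wzFactor_nonneg (x : ℝ) (k m : ℕ) : 0 ≤ wzFactor x k m := by
  unfold wzFactor; positivity

lemma wzFactor_two_mul_add_one_le {x : ℝ} (hx : 0 < x) (k : ℕ) :
    wzFactor x k (2 * k + 1) ≤ (1 / 2) ^ k * (1 / x ^ 2) := by
  have hle := mul_factorial_le_poch_succ hx (2 * k)
  have h0 : (0 : ℝ) < (2 * k).factorial := by positivity
  calc wzFactor x k (2 * k + 1)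
      ≤ (2 * k).factorial * (k.factorial : ℝ) ^ 2 / (x * (2 * k).factorial) ^ 2 := by
        unfold wzFactor
        gcongr
    _ = (k.factorial : ℝ) ^ 2 / (2 * k).factorial * (1 / x ^ 2) := by field_simp
    _ ≤ _ := by
        gcongr
        exact factorial_sq_div_factorial_two_mul_le k

lemma wzFactor_two_mul_add_two {x : ℝ} (hx : 0 < x) (k : ℕ) :
    wzFactor x k (2 * k + 2) = wzFactor x k (2 * k + 1) / (x + (2 * k + 1)) ^ 2 := by
  have := poch_pos hx (2 * k + 1)
  simp only [wzFactor, poch_succ x (2 * k + 1)]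
  push_cast
  field_simp

lemma abs_wzF_le (n k : ℕ) : |wzF n k| ≤ (1 / 2) ^ k * (13 * (1 / ((n : ℝ) + 1 / 2) ^ 2)) := by
  have hx : (1 : ℝ) / 2 ≤ n + 1 / 2 := by simp
  have hx' : (0 : ℝ) < n + 1 / 2 := by positivity
  rw [wzF, abs_mul, abs_neg_one_pow, one_mul, abs_mul, abs_of_nonneg (wzFactor_nonneg _ _ _)]
  calc _ ≤ (1 / 2) ^ k * (1 / ((n : ℝ) + 1 / 2) ^ 2) * 13 :=
        mul_le_mul (wzFactor_two_mul_add_one_le hx' k)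
          ((abs_wzWeight_le hx _ _).trans (by norm_num)) (abs_nonneg _) (by positivity)
    _ = _ := by ring

lemma abs_wzG_le (n k : ℕ) : |wzG n k| ≤ (1 / 2) ^ k * (13 * (1 / ((n : ℝ) + 1 / 2) ^ 2)) := by
  have hx : (1 : ℝ) / 2 ≤ n + 1 / 2 := by simp
  have hx' : (0 : ℝ) < n + 1 / 2 := by positivity
  have hn : (0 : ℝ) ≤ n := n.cast_nonneg
  have hk : (0 : ℝ) ≤ k := k.cast_nonneg
  set y : ℝ := n + 1 / 2 + (2 * k + 1) with hy
  have hy0 : 0 < y := by positivity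
  have hy1 : 1 ≤ y ^ 2 := by nlinarith
  have hP0 : 0 ≤ wzPoly n k := by unfold wzPoly; positivity
  have hP : wzPoly n k ≤ 2 * y ^ 2 := by
    unfold wzPoly
    nlinarith [mul_nonneg hn hk, mul_nonneg hn hn, mul_nonneg hk hk]
  have hbound : |wzPoly n k * wzWeight (n + 1 / 2) k (2 * k + 2) + 1 / 2| ≤ 13 * y ^ 2 := by
    refine (abs_add_le _ _).trans ?_
    rw [abs_mul, abs_of_nonneg hP0, abs_of_pos (by norm_num : (0 : ℝ) < 1 / 2)]
    have := mul_le_mul hP (abs_wzWeight_le hx k (2 * k + 2)) (abs_nonneg _) (by positivity)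
    linarith
  rw [wzG, abs_mul, abs_neg_one_pow, one_mul, abs_mul, abs_of_nonneg (wzFactor_nonneg _ _ _),
    wzFactor_two_mul_add_two hx', ← hy]
  have hF0 := wzFactor_nonneg ((n : ℝ) + 1 / 2) k (2 * k + 1)
  calc _ ≤ wzFactor ((n : ℝ) + 1 / 2) k (2 * k + 1) / y ^ 2 * (13 * y ^ 2) := by gcongr
    _ = wzFactor ((n : ℝ) + 1 / 2) k (2 * k + 1) * 13 := by field_simp
    _ ≤ (1 / 2) ^ k * (1 / ((n : ℝ) + 1 / 2) ^ 2) * 13 := by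
        gcongr
        exact wzFactor_two_mul_add_one_le hx' k
    _ = _ := by ring

lemma summable_one_div_odd_pow {p : ℕ} (hp : 1 < p) :
    Summable fun n : ℕ => 1 / (1 + 2 * (n : ℝ)) ^ p := by
  have h := (Real.summable_one_div_nat_pow.2 hp).comp_injective
    (i := fun n : ℕ => 2 * n + 1) fun a b hab => by simpa using hab
  refine h.congr fun n => ?_
  simp only [Function.comp_apply]
  push_cast
  rw [add_comm]

lemma summable_neg_one_pow_div_odd_pow {p : ℕ} (hp : 1 < p) :
    Summable fun n : ℕ => (-1 : ℝ) ^ n / (1 + 2 * (n : ℝ)) ^ p := by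
  refine Summable.of_norm_bounded (summable_one_div_odd_pow hp) fun n => le_of_eq ?_
  rw [Real.norm_eq_abs, abs_div, abs_neg_one_pow, abs_of_pos (by positivity)]

lemma tsum_wzF_zero : ∑' n, wzF n 0 = 16 * catalanG - 16 * beta4 := by
  rw [catalanG, beta4, ← tsum_mul_left, ← tsum_mul_left,
    ← ((summable_neg_one_pow_div_odd_pow (by norm_num)).mul_left 16).tsum_sub
      ((summable_neg_one_pow_div_odd_pow (by norm_num)).mul_left 16)]
  refine tsum_congr fun n => ?_
  have : (0 : ℝ) < 1 + 2 * n := by positivity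
  simp only [wzF, wzFactor, wzWeight, poch, H2, shiftedH2]
  simp
  rw [show (n : ℝ) + 2⁻¹ = (1 + 2 * n) / 2 by ring]
  field_simp
  ring

lemma summand_eq_wzG_zero (k : ℕ) :
    (-1/4 : ℝ) ^ k *
      (poch 1 k ^ 3 * poch (1/2) k / (poch (5/4) k ^ 2 * poch (7/4) k ^ 2)) *
      ((19 + 56 * (k : ℝ) + 40 * (k : ℝ) ^ 2) *
        (H2 k + H2 (1 + 2 * k) - 4 * H2 (3 + 4 * k) + 4) + 4) = 9 / 2 * wzG 0 k := by
  have h5 := poch_pos (by norm_num : (0 : ℝ) < 5 / 4) k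
  have h7 := poch_pos (by norm_num : (0 : ℝ) < 7 / 4) k
  simp only [wzG, wzFactor, wzWeight, wzPoly, Nat.cast_zero, zero_add, poch_half_two_mul_add_two,
    shiftedH2_half_succ (2 * k + 1), factorial_two_mul_eq_poch]
  rw [← poch_one, show 2 * (2 * k + 1) + 1 = 3 + 4 * k by ring, add_comm (2 * k) 1, div_pow]
  field_simp
  ring

theorem stmt14 :
    (∑' k : ℕ, (-1/4 : ℝ) ^ k *
      (poch 1 k ^ 3 * poch (1/2) k / (poch (5/4) k ^ 2 * poch (7/4) k ^ 2)) *
      ((19 + 56 * (k : ℝ) + 40 * (k : ℝ) ^ 2) *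
        (H2 k + H2 (1 + 2 * k) - 4 * H2 (3 + 4 * k) + 4) + 4)) =
      72 * catalanG - 72 * beta4 := by
  simp_rw [summand_eq_wzG_zero]
  have hu : Summable fun n : ℕ => 13 * (1 / ((n : ℝ) + 1 / 2) ^ 2) := by
    refine ((summable_one_div_odd_pow one_lt_two).mul_left 52).congr fun n => ?_
    rw [show (n : ℝ) + 1 / 2 = (1 + 2 * n) / 2 by ring]
    field_simp
    norm_num
  rw [tsum_mul_left, tsum_eq_tsum_of_wz_pair hu summable_geometric_two abs_wzF_le abs_wzG_le
    wzF_succ_sub, tsum_wzF_zero]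
  ring
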